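/- arXiv:1312.7739 — 7 statements merged into one kernel-verified Lean document; each statement's English description precedes it below -/
import Mathlib

section
/- Suppose f and g are multipliers of H_w, i.e. f·h ∈ H_w and g·h ∈ H_w for every h ∈ H_w, and suppose there are constants C_f, C_g with ‖f·h‖_{H_w} ≤ C_f ‖h‖_{H_w} and ‖g·h‖_{H_w} ≤ C_g ‖h‖_{H_w} for all h ∈ H_w. If both f and g are cyclic in H_w, then the Cauchy product f·g is cyclic in H_w. -/
open scoped BigOperators ComplexConjugate
open Filter

def MemHw (w : ℕ → ℝ) (f : ℕ → ℂ) : Prop :=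
  Summable fun n => w n * ‖f n‖ ^ 2

noncomputable def normSqHw (w : ℕ → ℝ) (f : ℕ → ℂ) : ℝ :=
  ∑' n, w n * ‖f n‖ ^ 2

noncomputable def normHw (w : ℕ → ℝ) (f : ℕ → ℂ) : ℝ :=
  Real.sqrt (normSqHw w f)

noncomputable def innerHw (w : ℕ → ℝ) (f g : ℕ → ℂ) : ℂ :=
  ∑' n, (w n : ℂ) * f n * conj (g n)

noncomputable def cProd (f g : ℕ → ℂ) : ℕ → ℂ :=
  fun n => ∑ k ∈ Finset.range (n + 1), f k * g (n - k)

def onePS : ℕ → ℂ := fun n => if n = 0 then 1 else 0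

def IsPolySeq (p : ℕ → ℂ) : Prop := ∃ N, ∀ n, N < n → p n = 0

def DegLE (p : ℕ → ℂ) (n : ℕ) : Prop := ∀ m, n < m → p m = 0

def CyclicHw (w : ℕ → ℝ) (f : ℕ → ℂ) : Prop :=
  ∀ ε : ℝ, 0 < ε → ∃ p : ℕ → ℂ, IsPolySeq p ∧ normHw w (cProd p f - onePS) < ε

noncomputable def taylorCoeff (F : ℂ → ℂ) (n : ℕ) : ℂ :=
  iteratedDeriv n F 0 / (n.factorial : ℂ)

noncomputable def phiW (w : ℕ → ℝ) (k : ℕ) : ℝ :=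
  ∑ j ∈ Finset.range (k + 1), 1 / w j

def oneSubZ : ℕ → ℂ := fun k => if k = 0 then 1 else if k = 1 then -1 else 0

def zPow (i : ℕ) (f : ℕ → ℂ) : ℕ → ℂ :=
  fun m => if i ≤ m then f (m - i) else 0

theorem mk_cProd (f g : ℕ → ℂ) :
    PowerSeries.mk (cProd f g) = PowerSeries.mk f * PowerSeries.mk g := by
  ext n
  simp [cProd, PowerSeries.coeff_mul,
    Finset.Nat.sum_antidiagonal_eq_sum_range_succ fun i j => f i * g j]

theorem mk_onePS : PowerSeries.mk onePS = 1 := by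
  ext n
  simp [onePS, PowerSeries.coeff_one]

theorem mk_sub (f g : ℕ → ℂ) :
    PowerSeries.mk (f - g) = PowerSeries.mk f - PowerSeries.mk g := by
  ext n
  simp

theorem mk_coeff (F : PowerSeries ℂ) : PowerSeries.mk (fun n => PowerSeries.coeff n F) = F := by
  ext n
  simp

/-- Membership of a formal power series in the weighted Hardy space. -/
def SeriesMem (w : ℕ → ℝ) (F : PowerSeries ℂ) : Prop :=
  MemHw w fun n => PowerSeries.coeff n F

/-- The squared weighted norm of a formal power series. -/
noncomputable def seriesNormSq (w : ℕ → ℝ) (F : PowerSeries ℂ) : ℝ :=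
  normSqHw w fun n => PowerSeries.coeff n F

/-- `F` multiplies the weighted Hardy space boundedly into itself. -/
def IsBoundedMultiplier (w : ℕ → ℝ) (F : PowerSeries ℂ) : Prop :=
  ∃ C : ℝ, 0 ≤ C ∧ ∀ H, SeriesMem w H →
    SeriesMem w (F * H) ∧ seriesNormSq w (F * H) ≤ C * seriesNormSq w H

theorem normSqHw_nonneg {w : ℕ → ℝ} (hw : ∀ n, 0 < w n) (f : ℕ → ℂ) : 0 ≤ normSqHw w f :=
  tsum_nonneg fun n => mul_nonneg (hw n).le (sq_nonneg _)

/-- Domination of partial weighted sums passes to the space and to the squared norm. -/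
theorem SeriesMem.of_le {w : ℕ → ℝ} (hw : ∀ n, 0 < w n) {F : PowerSeries ℂ} {u : ℕ → ℝ}
    (hu : Summable u) (h : ∀ n, w n * ‖PowerSeries.coeff n F‖ ^ 2 ≤ u n) :
    SeriesMem w F ∧ seriesNormSq w F ≤ ∑' n, u n := by
  have hs : SeriesMem w F :=
    Summable.of_nonneg_of_le (fun n => mul_nonneg (hw n).le (sq_nonneg _)) h hu
  exact ⟨hs, Summable.tsum_le_tsum h hs hu⟩

theorem norm_add_sq_le_two_mul (a b : ℂ) : ‖a + b‖ ^ 2 ≤ 2 * ‖a‖ ^ 2 + 2 * ‖b‖ ^ 2 := by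
  have := pow_le_pow_left₀ (norm_nonneg _) (norm_add_le a b) 2
  nlinarith [sq_nonneg (‖a‖ - ‖b‖)]

theorem SeriesMem.add {w : ℕ → ℝ} (hw : ∀ n, 0 < w n) {F G : PowerSeries ℂ}
    (hF : SeriesMem w F) (hG : SeriesMem w G) :
    SeriesMem w (F + G) ∧
      seriesNormSq w (F + G) ≤ 2 * seriesNormSq w F + 2 * seriesNormSq w G := by
  have hF' := Summable.mul_left 2 hF
  have hG' := Summable.mul_left 2 hG
  have key := SeriesMem.of_le hw (F := F + G) (hF'.add hG') fun n => by
    have := mul_le_mul_of_nonneg_left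
      (norm_add_sq_le_two_mul (PowerSeries.coeff n F) (PowerSeries.coeff n G)) (hw n).le
    rw [map_add]
    linarith
  rwa [hF'.tsum_add hG', tsum_mul_left, tsum_mul_left] at key

theorem SeriesMem.one (w : ℕ → ℝ) : SeriesMem w 1 := by
  refine summable_of_ne_finset_zero (s := {0}) fun n hn => ?_
  simp_all [PowerSeries.coeff_one]

theorem IsBoundedMultiplier.add {w : ℕ → ℝ} (hw : ∀ n, 0 < w n) {F G : PowerSeries ℂ}
    (hF : IsBoundedMultiplier w F) (hG : IsBoundedMultiplier w G) :
    IsBoundedMultiplier w (F + G) := by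
  obtain ⟨A, hA, hF⟩ := hF
  obtain ⟨B, hB, hG⟩ := hG
  refine ⟨2 * A + 2 * B, by positivity, fun H hH => ?_⟩
  have := (hF H hH).1.add hw (hG H hH).1
  rw [add_mul]
  exact ⟨this.1, by linarith [this.2, (hF H hH).2, (hG H hH).2]⟩

theorem IsBoundedMultiplier.mul {w : ℕ → ℝ} {F G : PowerSeries ℂ}
    (hF : IsBoundedMultiplier w F) (hG : IsBoundedMultiplier w G) :
    IsBoundedMultiplier w (F * G) := by
  obtain ⟨A, hA, hF⟩ := hF
  obtain ⟨B, hB, hG⟩ := hG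
  refine ⟨A * B, by positivity, fun H hH => ?_⟩
  have h := hF _ (hG H hH).1
  rw [mul_assoc F G H, mul_assoc A B]
  exact ⟨h.1, h.2.trans (mul_le_mul_of_nonneg_left (hG H hH).2 hA)⟩

theorem IsBoundedMultiplier.C {w : ℕ → ℝ} (hw : ∀ n, 0 < w n) (a : ℂ) :
    IsBoundedMultiplier w (PowerSeries.C a) := by
  refine ⟨‖a‖ ^ 2, by positivity, fun H hH => ?_⟩
  have key := SeriesMem.of_le hw (F := PowerSeries.C a * H) (Summable.mul_left (‖a‖ ^ 2) hH)
    fun n => by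
      rw [PowerSeries.coeff_C_mul, norm_mul, mul_pow]
      exact le_of_eq (by ring)
  rwa [tsum_mul_left] at key

theorem IsBoundedMultiplier.X {w : ℕ → ℝ} (hw : ∀ n, 0 < w n)
    (hw1 : Tendsto (fun n => w (n + 1) / w n) atTop (nhds 1)) :
    IsBoundedMultiplier w PowerSeries.X := by
  obtain ⟨M, hM⟩ := hw1.bddAbove_range
  have hM' : ∀ n, w (n + 1) ≤ M * w n := fun n =>
    (div_le_iff₀ (hw n)).1 (hM ⟨n, rfl⟩)
  have hM0 : 0 ≤ M := (div_pos (hw 1) (hw 0)).le.trans (hM ⟨0, rfl⟩)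
  refine ⟨M, hM0, fun H hH => ?_⟩
  have hle : ∀ n, w (n + 1) * ‖PowerSeries.coeff (n + 1) (PowerSeries.X * H)‖ ^ 2 ≤
      M * (w n * ‖PowerSeries.coeff n H‖ ^ 2) := fun n => by
    rw [PowerSeries.coeff_succ_X_mul, ← mul_assoc]
    exact mul_le_mul_of_nonneg_right (hM' n) (sq_nonneg _)
  have hs := Summable.mul_left M hH
  have hs1 := Summable.of_nonneg_of_le
    (fun n => mul_nonneg (hw (n + 1)).le (sq_nonneg _)) hle hs
  have hmem : SeriesMem w (PowerSeries.X * H) :=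
    (summable_nat_add_iff (f := fun n => w n * ‖PowerSeries.coeff n (PowerSeries.X * H)‖ ^ 2) 1).1
      hs1
  refine ⟨hmem, ?_⟩
  have h0 := Summable.tsum_eq_zero_add hmem
  have h1 := Summable.tsum_le_tsum hle hs1 hs
  rw [tsum_mul_left] at h1
  simp only [PowerSeries.coeff_zero_X_mul, norm_zero, ne_eq, OfNat.ofNat_ne_zero,
    not_false_eq_true, zero_pow, mul_zero, zero_add] at h0
  exact h0.trans_le h1

theorem IsBoundedMultiplier.polynomial {w : ℕ → ℝ} (hw : ∀ n, 0 < w n)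
    (hw1 : Tendsto (fun n => w (n + 1) / w n) atTop (nhds 1)) (P : Polynomial ℂ) :
    IsBoundedMultiplier w (P : PowerSeries ℂ) := by
  induction P using Polynomial.induction_on with
  | C a => simpa using IsBoundedMultiplier.C hw a
  | add P Q hP hQ => simpa using hP.add hw hQ
  | monomial n a h =>
    rw [pow_succ, ← mul_assoc, Polynomial.coe_mul, Polynomial.coe_X]
    exact h.mul (IsBoundedMultiplier.X hw hw1)

theorem IsBoundedMultiplier.of_normHw_le {w : ℕ → ℝ} (hw : ∀ n, 0 < w n) {f : ℕ → ℂ} {C : ℝ}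
    (hm : ∀ h : ℕ → ℂ, MemHw w h → MemHw w (cProd f h))
    (hC : ∀ h : ℕ → ℂ, MemHw w h → normHw w (cProd f h) ≤ C * normHw w h) :
    IsBoundedMultiplier w (PowerSeries.mk f) := by
  refine ⟨C ^ 2, sq_nonneg C, fun H hH => ?_⟩
  have hcoeff : (fun n => PowerSeries.coeff n (PowerSeries.mk f * H)) =
      cProd f fun n => PowerSeries.coeff n H := by
    funext n
    rw [← PowerSeries.coeff_mk n (cProd _ _), mk_cProd, mk_coeff]
  unfold SeriesMem seriesNormSq
  rw [hcoeff]
  refine ⟨hm _ hH, ?_⟩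
  have h := pow_le_pow_left₀ (Real.sqrt_nonneg _) (hC _ hH) 2
  rwa [mul_pow, normHw, Real.sq_sqrt (normSqHw_nonneg hw _),
    Real.sq_sqrt (normSqHw_nonneg hw _)] at h

theorem IsPolySeq.exists_polynomial {p : ℕ → ℂ} (hp : IsPolySeq p) :
    ∃ P : Polynomial ℂ, (P : PowerSeries ℂ) = PowerSeries.mk p := by
  obtain ⟨N, hN⟩ := hp
  refine ⟨PowerSeries.trunc (N + 1) (PowerSeries.mk p), ?_⟩
  ext n
  rw [Polynomial.coeff_coe, PowerSeries.coeff_trunc, PowerSeries.coeff_mk]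
  split_ifs with h
  · rfl
  · exact (hN n (by omega)).symm

theorem normHw_eq_sqrt_seriesNormSq (w : ℕ → ℝ) (f : ℕ → ℂ) :
    normHw w f = Real.sqrt (seriesNormSq w (PowerSeries.mk f)) := by
  simp [normHw, seriesNormSq]

theorem cyclicHw_iff {w : ℕ → ℝ} {f : ℕ → ℂ} :
    CyclicHw w f ↔ ∀ ε : ℝ, 0 < ε → ∃ P : Polynomial ℂ,
      seriesNormSq w ((P : PowerSeries ℂ) * PowerSeries.mk f - 1) < ε := by
  constructor
  · intro h ε hε
    obtain ⟨p, hp, hlt⟩ := h (Real.sqrt ε) (Real.sqrt_pos.2 hε)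
    obtain ⟨P, hP⟩ := hp.exists_polynomial
    refine ⟨P, ?_⟩
    rw [normHw_eq_sqrt_seriesNormSq, mk_sub, mk_cProd, mk_onePS, ← hP] at hlt
    exact lt_of_not_ge fun hge => hlt.not_ge (Real.sqrt_le_sqrt hge)
  · intro h ε hε
    obtain ⟨P, hP⟩ := h (ε ^ 2) (pow_pos hε 2)
    refine ⟨P.coeff, ⟨P.natDegree, fun n => Polynomial.coeff_eq_zero_of_natDegree_lt⟩, ?_⟩
    have hmk : PowerSeries.mk P.coeff = (P : PowerSeries ℂ) := by
      ext n
      simp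
    rw [normHw_eq_sqrt_seriesNormSq, mk_sub, mk_cProd, mk_onePS, hmk]
    exact (Real.sqrt_lt' hε).2 hP

theorem SeriesMem.multiplier_sub_one {w : ℕ → ℝ} (hw : ∀ n, 0 < w n) {F : PowerSeries ℂ}
    (hF : IsBoundedMultiplier w F) : SeriesMem w (F - 1) := by
  obtain ⟨A, -, hA⟩ := hF.add hw (IsBoundedMultiplier.C hw (-1))
  simpa [sub_eq_add_neg] using (hA 1 (SeriesMem.one w)).1

theorem product_of_cyclic_multipliers_is_cyclic
    (w : ℕ → ℝ) (hw : ∀ n, 0 < w n)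
    (hw1 : Filter.Tendsto (fun n => w (n + 1) / w n) Filter.atTop (nhds 1))
    (f g : ℕ → ℂ) (Cf Cg : ℝ)
    (hfm : ∀ h : ℕ → ℂ, MemHw w h → MemHw w (cProd f h))
    (hgm : ∀ h : ℕ → ℂ, MemHw w h → MemHw w (cProd g h))
    (hCf : ∀ h : ℕ → ℂ, MemHw w h → normHw w (cProd f h) ≤ Cf * normHw w h)
    (hCg : ∀ h : ℕ → ℂ, MemHw w h → normHw w (cProd g h) ≤ Cg * normHw w h)
    (hfc : CyclicHw w f) (hgc : CyclicHw w g) :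
    CyclicHw w (cProd f g) := by
  rw [cyclicHw_iff] at *
  have hf := IsBoundedMultiplier.of_normHw_le hw hfm hCf
  have hg := IsBoundedMultiplier.of_normHw_le hw hgm hCg
  intro ε hε
  obtain ⟨P, hP⟩ := hfc (ε / 4) (by positivity)
  have hPf := (IsBoundedMultiplier.polynomial hw hw1 P).mul hf
  obtain ⟨A, hA, hbound⟩ := id hPf
  obtain ⟨Q, hQ⟩ := hgc (ε / (4 * (A + 1))) (by positivity)
  have hQg := (IsBoundedMultiplier.polynomial hw hw1 Q).mul hg
  have hu := hbound _ (SeriesMem.multiplier_sub_one hw hQg)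
  have hsum := (hu.1.add hw (SeriesMem.multiplier_sub_one hw hPf)).2
  refine ⟨P * Q, ?_⟩
  rw [mk_cProd, Polynomial.coe_mul]
  rw [show (P : PowerSeries ℂ) * Q * (PowerSeries.mk f * PowerSeries.mk g) - 1 =
      P * PowerSeries.mk f * (Q * PowerSeries.mk g - 1) + (P * PowerSeries.mk f - 1) by ring]
  rw [lt_div_iff₀ (by positivity)] at hQ
  have hnonneg : 0 ≤ seriesNormSq w ((Q : PowerSeries ℂ) * PowerSeries.mk g - 1) :=
    normSqHw_nonneg hw _
  linarith [hu.2]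
end

section
/- Let R > 1 and let F : ℂ → ℂ be analytic on the open ball of radius R centered at 0, with F(z) ≠ 0 for every z with |z| ≤ 1. Let a_n be the Taylor coefficients of F at 0. Then the sequence a belongs to H_w and is cyclic in H_w. -/
open scoped BigOperators ComplexConjugate
open Filter

theorem summable_weight_mul_sq {w : ℕ → ℝ} (hw : ∀ n, 0 < w n)
    (hw1 : Tendsto (fun n => w (n + 1) / w n) atTop (nhds 1)) {q : ℝ} (hq0 : 0 < q) (hq1 : q < 1) :
    Summable fun n : ℕ => w n * (((n : ℝ) + 1) * q ^ n) ^ 2 := by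
  have hpos : ∀ n : ℕ, 0 < w n * (((n : ℝ) + 1) * q ^ n) ^ 2 := fun n => by
    have := hw n
    positivity
  refine summable_of_ratio_test_tendsto_lt_one (l := q ^ 2) (by nlinarith)
    (Eventually.of_forall fun n => (hpos n).ne') ?_
  have hlim : Tendsto (fun n : ℕ => w (n + 1) / w n * (1 + 1 / ((n : ℝ) + 1)) ^ 2 * q ^ 2)
      atTop (nhds (1 * (1 + 0) ^ 2 * q ^ 2)) :=
    (hw1.mul ((tendsto_one_div_add_atTop_nhds_zero_nat.const_add 1).pow 2)).mul_const _
  simp only [add_zero, one_pow, mul_one, one_mul] at hlim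
  refine hlim.congr fun n => ?_
  rw [Real.norm_of_nonneg (hpos _).le, Real.norm_of_nonneg (hpos _).le]
  have := (hw n).ne'
  push_cast
  field_simp
  ring

theorem exists_norm_taylorCoeff_le {F : ℂ → ℂ} {r ρ : ℝ} (hr : 0 < r) (hrρ : r < ρ)
    (hF : ∀ z ∈ Metric.ball (0 : ℂ) ρ, AnalyticAt ℂ F z) :
    ∃ C, 0 ≤ C ∧ ∀ n, ‖taylorCoeff F n‖ ≤ C * r⁻¹ ^ n := by
  have hd : DifferentiableOn ℂ F (Metric.ball 0 ρ) := fun z hz =>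
    (hF z hz).differentiableAt.differentiableWithinAt
  have hsub : Metric.closedBall (0 : ℂ) r ⊆ Metric.ball 0 ρ := Metric.closedBall_subset_ball hrρ
  obtain ⟨C, hC⟩ := (isCompact_closedBall (0 : ℂ) r).exists_bound_of_continuousOn
    (hd.continuousOn.mono hsub)
  refine ⟨C, (norm_nonneg _).trans (hC 0 (Metric.mem_closedBall_self hr.le)), fun n => ?_⟩
  have h := Complex.norm_iteratedDeriv_le_of_forall_mem_sphere_norm_le n hr
    (hd.diffContOnCl_ball hsub) fun z hz => hC z (Metric.sphere_subset_closedBall hz)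
  have hn : (0 : ℝ) < n.factorial := by exact_mod_cast n.factorial_pos
  rw [taylorCoeff, norm_div, Complex.norm_natCast, div_le_iff₀ hn]
  refine h.trans (le_of_eq ?_)
  rw [inv_pow]
  ring

theorem taylorCoeff_mul {F G : ℂ → ℂ} (hF : AnalyticAt ℂ F 0) (hG : AnalyticAt ℂ G 0) :
    taylorCoeff (F * G) = cProd (taylorCoeff F) (taylorCoeff G) := by
  ext n
  rw [taylorCoeff, iteratedDeriv_mul hF.contDiffAt hG.contDiffAt, Finset.sum_div, cProd]
  refine Finset.sum_congr rfl fun k hk => ?_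
  have hkn : k ≤ n := Nat.lt_succ_iff.mp (Finset.mem_range.mp hk)
  rw [taylorCoeff, taylorCoeff, Nat.cast_choose ℂ hkn]
  have h1 : (n.factorial : ℂ) ≠ 0 := by exact_mod_cast n.factorial_ne_zero
  have h2 : (k.factorial : ℂ) ≠ 0 := by exact_mod_cast k.factorial_ne_zero
  have h3 : ((n - k).factorial : ℂ) ≠ 0 := by exact_mod_cast (n - k).factorial_ne_zero
  field_simp

theorem cProd_taylorCoeff_inv {F : ℂ → ℂ} (hF : AnalyticAt ℂ F 0) (h0 : F 0 ≠ 0) :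
    cProd (taylorCoeff F⁻¹) (taylorCoeff F) = onePS := by
  rw [← taylorCoeff_mul (hF.inv h0) hF]
  have heq : F⁻¹ * F =ᶠ[nhds 0] fun _ => 1 := by
    filter_upwards [hF.continuousAt.eventually_ne h0] with z hz
    simp [hz]
  ext n
  rw [taylorCoeff, heq.iteratedDeriv_eq n, iteratedDeriv_const, onePS]
  split_ifs with hn <;> simp [hn]

theorem exists_one_lt_ball_ne_zero {F : ℂ → ℂ} {R : ℝ} (hR : 1 < R)
    (hF : ContinuousOn F (Metric.ball 0 R)) (hFz : ∀ z : ℂ, ‖z‖ ≤ 1 → F z ≠ 0) :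
    ∃ ρ, 1 < ρ ∧ ∀ z ∈ Metric.ball (0 : ℂ) ρ, z ∈ Metric.ball (0 : ℂ) R ∧ F z ≠ 0 := by
  have ho := hF.isOpen_inter_preimage Metric.isOpen_ball isOpen_compl_singleton (t := {(0 : ℂ)}ᶜ)
  obtain ⟨δ, hδ, hsub⟩ := (isCompact_closedBall (0 : ℂ) 1).exists_thickening_subset_open ho
    fun z hz => ⟨Metric.closedBall_subset_ball hR hz, hFz z (mem_closedBall_zero_iff.mp hz)⟩
  rw [thickening_closedBall hδ zero_le_one] at hsub
  exact ⟨δ + 1, by linarith, fun z hz => hsub hz⟩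

theorem norm_cProd_le {f g : ℕ → ℂ} {B C q : ℝ} (hf : ∀ n, ‖f n‖ ≤ B * q ^ n)
    (hg : ∀ n, ‖g n‖ ≤ C * q ^ n) (n : ℕ) :
    ‖cProd f g n‖ ≤ B * C * (((n : ℝ) + 1) * q ^ n) := by
  calc ‖cProd f g n‖ ≤ ∑ k ∈ Finset.range (n + 1), B * C * q ^ n := by
        refine norm_sum_le_of_le _ fun k hk => ?_
        rw [norm_mul]
        refine (mul_le_mul (hf k) (hg (n - k)) (norm_nonneg _)
          ((norm_nonneg _).trans (hf k))).trans (le_of_eq ?_)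
        rw [← pow_mul_pow_sub q (Nat.lt_succ_iff.mp (Finset.mem_range.mp hk))]
        ring
    _ = B * C * (((n : ℝ) + 1) * q ^ n) := by
        rw [Finset.sum_const, Finset.card_range, nsmul_eq_mul]
        push_cast
        ring

theorem cyclicHw_of_inverse {w m : ℕ → ℝ} (hw : ∀ n, 0 < w n) {a b : ℕ → ℂ} {B C q : ℝ}
    (hq : 0 ≤ q) (hB : 0 ≤ B) (hb : ∀ n, ‖b n‖ ≤ B * q ^ n) (ha : ∀ n, ‖a n‖ ≤ C * q ^ n)
    (hba : cProd b a = onePS) (hm : ∀ n : ℕ, m n = w n * (((n : ℝ) + 1) * q ^ n) ^ 2)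
    (hsum : Summable m) : CyclicHw w a := by
  intro ε hε
  have htail : Tendsto (fun N => (B * C) ^ 2 * ∑' k, m (k + N)) atTop (nhds 0) := by
    simpa using (tendsto_sum_nat_add m).const_mul ((B * C) ^ 2)
  obtain ⟨N, hN⟩ := (htail.eventually (gt_mem_nhds (pow_pos hε 2))).exists
  refine ⟨fun n => if n < N then b n else 0, ⟨N, fun n hn => if_neg hn.not_gt⟩, ?_⟩
  set t : ℕ → ℂ := fun n => if n < N then 0 else b n with ht
  have hdiff : ∀ n, ‖(cProd (fun n => if n < N then b n else 0) a - onePS) n‖ = ‖cProd t a n‖ := by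
    intro n
    rw [← hba, ← norm_neg (cProd t a n), Pi.sub_apply, cProd, cProd, cProd,
      ← Finset.sum_sub_distrib, ← Finset.sum_neg_distrib]
    congr 1
    refine Finset.sum_congr rfl fun k _ => ?_
    simp only [ht]
    split_ifs <;> ring
  have hzero : ∀ n < N, cProd t a n = 0 := by
    intro n hn
    refine Finset.sum_eq_zero fun k hk => ?_
    have hk' := Finset.mem_range.mp hk
    simp only [ht]
    rw [if_pos (by omega), zero_mul]
  have htb : ∀ n, ‖t n‖ ≤ B * q ^ n := by
    intro n
    simp only [ht]
    split_ifs
    · rw [norm_zero]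
      positivity
    · exact hb n
  have hle : ∀ n, w n * ‖cProd t a n‖ ^ 2 ≤ (B * C) ^ 2 * m n := by
    intro n
    have h := pow_le_pow_left₀ (norm_nonneg _) (norm_cProd_le htb ha n) 2
    rw [hm]
    refine (mul_le_mul_of_nonneg_left h (hw n).le).trans (le_of_eq ?_)
    ring
  have hnn : ∀ n, 0 ≤ w n * ‖cProd t a n‖ ^ 2 := fun n => mul_nonneg (hw n).le (sq_nonneg _)
  have hs : Summable fun n => w n * ‖cProd t a n‖ ^ 2 :=
    Summable.of_nonneg_of_le hnn hle (hsum.mul_left _)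
  rw [normHw, normSqHw, Real.sqrt_lt' hε]
  simp only [hdiff]
  rw [← hs.sum_add_tsum_nat_add N, Finset.sum_eq_zero, zero_add]
  · refine lt_of_le_of_lt ?_ hN
    rw [← tsum_mul_left]
    exact Summable.tsum_le_tsum (fun k => hle (k + N)) ((summable_nat_add_iff N).mpr hs)
      (((summable_nat_add_iff N).mpr hsum).mul_left _)
  · intro n hn
    rw [hzero n (Finset.mem_range.mp hn)]
    simp

theorem no_zeros_closed_disc_implies_cyclic
    (w : ℕ → ℝ) (hw : ∀ n, 0 < w n)
    (hw1 : Filter.Tendsto (fun n => w (n + 1) / w n) Filter.atTop (nhds 1))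
    (R : ℝ) (hR : 1 < R) (F : ℂ → ℂ)
    (hF : ∀ z ∈ Metric.ball (0 : ℂ) R, AnalyticAt ℂ F z)
    (hFz : ∀ z : ℂ, ‖z‖ ≤ 1 → F z ≠ 0) :
    MemHw w (taylorCoeff F) ∧ CyclicHw w (taylorCoeff F) := by
  obtain ⟨ρ, hρ, hball⟩ := exists_one_lt_ball_ne_zero hR
    (fun z hz => (hF z hz).continuousAt.continuousWithinAt) hFz
  obtain ⟨r, hr1, hrρ⟩ := exists_between hρ
  have hr0 : 0 < r := by linarith
  obtain ⟨C, -, ha⟩ := exists_norm_taylorCoeff_le hr0 hrρ fun z hz => hF z (hball z hz).1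
  obtain ⟨B, hB, hb⟩ := exists_norm_taylorCoeff_le (F := F⁻¹) hr0 hrρ
    fun z hz => (hF z (hball z hz).1).inv (hball z hz).2
  have hq : 0 < r⁻¹ := inv_pos.mpr hr0
  have hsum := summable_weight_mul_sq hw hw1 hq (inv_lt_one_of_one_lt₀ hr1)
  refine ⟨Summable.of_nonneg_of_le (fun n => mul_nonneg (hw n).le (sq_nonneg _)) (fun n => ?_)
    (hsum.mul_left (C ^ 2)), cyclicHw_of_inverse hw hq.le hB hb ha
      (cProd_taylorCoeff_inv (hF 0 (Metric.mem_ball_self (by linarith))) (hFz 0 (by simp)))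
      (fun _ => rfl) hsum⟩
  have h := pow_le_pow_left₀ (norm_nonneg _) (ha n) 2
  have h1 : (1 : ℝ) ≤ ((n : ℝ) + 1) ^ 2 := one_le_pow₀ (by linarith [n.cast_nonneg (α := ℝ)])
  calc w n * ‖taylorCoeff F n‖ ^ 2 ≤ w n * (C * r⁻¹ ^ n) ^ 2 :=
        mul_le_mul_of_nonneg_left h (hw n).le
    _ ≤ w n * (C * r⁻¹ ^ n) ^ 2 * ((n : ℝ) + 1) ^ 2 :=
        le_mul_of_one_le_right (mul_nonneg (hw n).le (sq_nonneg _)) h1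
    _ = C ^ 2 * (w n * (((n : ℝ) + 1) * r⁻¹ ^ n) ^ 2) := by ring
end

section
/- Let w : ℕ → ℝ with w_n > 0 for all n, let n ≥ 0, and let f = 1 − z (the sequence (1, −1, 0, 0, …)). For a polynomial p of degree at most n with coefficients a_0,…,a_n, set a_{−1} = 1 and a_{n+1} = 0, so that ‖p·f − 1‖²_{H_w} = ∑_{k=0}^{n+1} w_k |a_k − a_{k−1}|². Then the minimum of ‖p·f − 1‖²_{H_w} over all polynomials p of degree at most n equals (∑_{k=0}^{n+1} 1/w_k)^{−1}, and it is attained by the polynomial p*_n with coefficients a_k = 1 − (∑_{j=0}^k 1/w_j)/(∑_{j=0}^{n+1} 1/w_j) for 0 ≤ k ≤ n. -/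
open scoped BigOperators ComplexConjugate
open Filter

/-- The coefficients of the `n`-th optimal approximant to `1/(1-z)`. -/
noncomputable def pstarW (w : ℕ → ℝ) (n : ℕ) : ℕ → ℂ :=
  fun k => if k ≤ n then ((1 - phiW w k / phiW w (n + 1) : ℝ) : ℂ) else 0

/-- The `k`-th coefficient of `p * (1 - z) - 1`. -/
noncomputable def residualCoeff (p : ℕ → ℂ) (k : ℕ) : ℂ :=
  if k = 0 then p 0 - 1 else p k - p (k - 1)

lemma cProd_oneSubZ_sub_onePS (p : ℕ → ℂ) : cProd p oneSubZ - onePS = residualCoeff p := by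
  funext k
  cases k with
  | zero => simp [cProd, oneSubZ, onePS, residualCoeff]
  | succ m =>
    have hvanish : ∑ k ∈ Finset.range m, p k * oneSubZ (m + 1 - k) = 0 := by
      refine Finset.sum_eq_zero fun k hk => ?_
      have hk' := Finset.mem_range.mp hk
      simp [oneSubZ, show m + 1 - k ≠ 0 by omega, show m + 1 - k ≠ 1 by omega]
    simp only [Pi.sub_apply, cProd, Finset.sum_range_succ, hvanish]
    simp [oneSubZ, onePS, residualCoeff]
    ring

lemma sum_range_succ_residualCoeff (p : ℕ → ℂ) (m : ℕ) :
    ∑ k ∈ Finset.range (m + 1), residualCoeff p k = p m - 1 := by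
  induction m with
  | zero => simp [residualCoeff]
  | succ m ih =>
    rw [Finset.sum_range_succ, ih]
    simp [residualCoeff]

lemma normSqHw_cProd_oneSubZ_sub_onePS (w : ℕ → ℝ) {p : ℕ → ℂ} {n : ℕ} (hp : DegLE p n) :
    normSqHw w (cProd p oneSubZ - onePS)
      = ∑ k ∈ Finset.range (n + 2), w k * ‖residualCoeff p k‖ ^ 2 := by
  rw [cProd_oneSubZ_sub_onePS, normSqHw]
  refine tsum_eq_sum fun k hk => ?_
  have hk' : n + 2 ≤ k := by simpa using hk
  have hzero : residualCoeff p k = 0 := by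
    rw [residualCoeff, if_neg (by omega), hp k (by omega), hp (k - 1) (by omega), sub_zero]
  simp [hzero]

lemma inv_sum_le_sum_mul_norm_sq {ι : Type*} (s : Finset ι) {w : ι → ℝ} (hw : ∀ i ∈ s, 0 < w i)
    {d : ι → ℂ} (hd : ‖∑ i ∈ s, d i‖ = 1) :
    (∑ i ∈ s, 1 / w i)⁻¹ ≤ ∑ i ∈ s, w i * ‖d i‖ ^ 2 := by
  have hne : s.Nonempty := by
    rw [Finset.nonempty_iff_ne_empty]
    rintro rfl
    simp at hd
  have hpos : 0 < ∑ i ∈ s, 1 / w i := Finset.sum_pos (fun i hi => one_div_pos.mpr (hw i hi)) hne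
  have hone : 1 ≤ ∑ i ∈ s, ‖d i‖ := hd ▸ norm_sum_le s d
  have hcs : (∑ i ∈ s, ‖d i‖) ^ 2 ≤ (∑ i ∈ s, 1 / w i) * ∑ i ∈ s, w i * ‖d i‖ ^ 2 :=
    Finset.sum_sq_le_sum_mul_sum_of_sq_le_mul s
      (fun i hi => (one_div_pos.mpr (hw i hi)).le)
      (fun i hi => mul_nonneg (hw i hi).le (sq_nonneg _))
      (fun i hi => by
        refine le_of_eq ?_
        have := (hw i hi).ne'
        field_simp)
  rw [inv_le_iff_one_le_mul₀' hpos]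
  exact (one_le_pow₀ hone).trans hcs

lemma phiW_pos {w : ℕ → ℝ} (hw : ∀ n, 0 < w n) (k : ℕ) : 0 < phiW w k :=
  Finset.sum_pos (fun j _ => one_div_pos.mpr (hw j)) Finset.nonempty_range_add_one

lemma degLE_pstarW (w : ℕ → ℝ) (n : ℕ) : DegLE (pstarW w n) n :=
  fun _ hm => if_neg (not_le.mpr hm)

lemma pstarW_of_le_succ {w : ℕ → ℝ} (hw : ∀ n, 0 < w n) {n k : ℕ} (hk : k ≤ n + 1) :
    pstarW w n k = ((1 - phiW w k / phiW w (n + 1) : ℝ) : ℂ) := by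
  rcases hk.eq_or_lt with rfl | hk
  · simp [pstarW, div_self (phiW_pos hw (n + 1)).ne']
  · exact if_pos (Nat.lt_succ_iff.mp hk)

lemma residualCoeff_pstarW {w : ℕ → ℝ} (hw : ∀ n, 0 < w n) {n k : ℕ} (hk : k ≤ n + 1) :
    residualCoeff (pstarW w n) k = ((-(1 / w k / phiW w (n + 1)) : ℝ) : ℂ) := by
  cases k with
  | zero => simp [residualCoeff, pstarW, phiW]
  | succ m =>
    rw [residualCoeff, if_neg m.succ_ne_zero, Nat.add_sub_cancel, pstarW_of_le_succ hw hk,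
      pstarW_of_le_succ hw (by omega : m ≤ n + 1), ← Complex.ofReal_sub]
    have hstep : phiW w (m + 1) = phiW w m + 1 / w (m + 1) := Finset.sum_range_succ _ _
    congr 1
    rw [hstep]
    ring

theorem optimal_norm_one_sub_z
    (w : ℕ → ℝ) (hw : ∀ n, 0 < w n) (n : ℕ) :
    (∀ p : ℕ → ℂ, DegLE p n →
      normSqHw w (cProd p oneSubZ - onePS)
        = ∑ k ∈ Finset.range (n + 2),
            w k * ‖if k = 0 then p 0 - 1 else p k - p (k - 1)‖ ^ 2) ∧
    (∀ p : ℕ → ℂ, DegLE p n →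
      (∑ k ∈ Finset.range (n + 2), 1 / w k)⁻¹
        ≤ normSqHw w (cProd p oneSubZ - onePS)) ∧
    DegLE (pstarW w n) n ∧
    normSqHw w (cProd (pstarW w n) oneSubZ - onePS)
      = (∑ k ∈ Finset.range (n + 2), 1 / w k)⁻¹ := by
  refine ⟨fun p hp => normSqHw_cProd_oneSubZ_sub_onePS w hp, fun p hp => ?_,
    degLE_pstarW w n, ?_⟩
  · rw [normSqHw_cProd_oneSubZ_sub_onePS w hp]
    refine inv_sum_le_sum_mul_norm_sq _ (fun k _ => hw k) ?_
    rw [sum_range_succ_residualCoeff, hp (n + 1) n.lt_succ_self]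
    simp
  · rw [normSqHw_cProd_oneSubZ_sub_onePS w (degLE_pstarW w n)]
    have hterm : ∀ k ∈ Finset.range (n + 2),
        w k * ‖residualCoeff (pstarW w n) k‖ ^ 2 = 1 / w k * (phiW w (n + 1) ^ 2)⁻¹ := by
      intro k hk
      have := (hw k).ne'
      have := (phiW_pos hw (n + 1)).ne'
      rw [residualCoeff_pstarW hw (Nat.lt_succ_iff.mp (Finset.mem_range.mp hk)),
        Complex.norm_real, Real.norm_eq_abs, sq_abs]
      field_simp
    rw [Finset.sum_congr rfl hterm, ← Finset.sum_mul]
    change phiW w (n + 1) * (phiW w (n + 1) ^ 2)⁻¹ = (phiW w (n + 1))⁻¹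
    have := (phiW_pos hw (n + 1)).ne'
    field_simp
end

section
/- Let H be a complex Hilbert space, let w : ℕ → ℝ with w_n > 0 for all n, let c_1, c_2 > 0, and let v : ℕ → H be such that for every finitely supported sequence a : ℕ → ℂ one has c_1 ∑_n w_n |a_n|² ≤ ‖∑_n a_n v_n‖² ≤ c_2 ∑_n w_n |a_n|². Then for every n ≥ 0, writing ε_n² for the infimum over all a_0,…,a_n ∈ ℂ (with the conventions a_{−1} = 1 and a_{n+1} = 0) of ‖∑_{k=0}^{n+1} (a_k − a_{k−1}) v_k‖², one has c_1 ≤ ε_n² · ∑_{k=0}^{n+1} 1/w_k ≤ c_2. -/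
/-- The coefficient of `z ^ k` in `(1 - z) * p(z) - 1`, where `p(z) = ∑ k ≤ n, a k * z ^ k`. -/
def differenceCoeff (n : ℕ) (a : ℕ → ℂ) (k : ℕ) : ℂ :=
  (if k ≤ n then a k else 0) - (if k = 0 then 1 else if k ≤ n + 1 then a (k - 1) else 0)

theorem sum_differenceCoeff (n : ℕ) (a : ℕ → ℂ) :
    ∑ k ∈ Finset.range (n + 2), differenceCoeff n a k = -1 := by
  have h₁ : ∑ k ∈ Finset.range (n + 2), (if k ≤ n then a k else 0) =
      ∑ k ∈ Finset.range (n + 1), a k := by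
    rw [Finset.sum_range_succ, if_neg (by omega), add_zero]
    refine Finset.sum_congr rfl fun k hk => if_pos ?_
    have := Finset.mem_range.1 hk
    omega
  have h₂ : ∑ k ∈ Finset.range (n + 2),
      (if k = 0 then 1 else if k ≤ n + 1 then a (k - 1) else 0) =
      ∑ k ∈ Finset.range (n + 1), a k + 1 := by
    rw [Finset.sum_range_succ', if_pos rfl]
    congr 1
    refine Finset.sum_congr rfl fun k hk => ?_
    have := Finset.mem_range.1 hk
    rw [if_neg (by omega), if_pos (by omega), Nat.add_sub_cancel]
  simp only [differenceCoeff]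
  rw [Finset.sum_sub_distrib, h₁, h₂]
  ring

/-- Every sequence summing to `-1` over `range (n + 2)` is a sequence of difference coefficients. -/
theorem exists_differenceCoeff_eq (n : ℕ) (d : ℕ → ℂ)
    (hd : ∑ k ∈ Finset.range (n + 2), d k = -1) :
    ∃ a : ℕ → ℂ, ∀ k ∈ Finset.range (n + 2), differenceCoeff n a k = d k := by
  refine ⟨fun k => 1 + ∑ j ∈ Finset.range (k + 1), d j, fun k hk => ?_⟩
  have hk' := Finset.mem_range.1 hk
  rcases k with _ | k
  · simp [differenceCoeff]
  · rw [differenceCoeff, if_neg (Nat.succ_ne_zero k), if_pos (show k + 1 ≤ n + 1 by omega), Nat.add_sub_cancel]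
    by_cases hkn : k + 1 ≤ n
    · rw [if_pos hkn, Finset.sum_range_succ _ (k + 1)]
      ring
    · obtain rfl : k = n := by omega
      rw [if_neg hkn]
      rw [Finset.sum_range_succ] at hd
      linear_combination -hd

/-- Cauchy–Schwarz inequality with weights. -/
theorem norm_sum_sq_le_weighted {ι E : Type*} [SeminormedAddCommGroup E] (s : Finset ι)
    (w : ι → ℝ) (hw : ∀ i ∈ s, 0 < w i) (d : ι → E) :
    ‖∑ i ∈ s, d i‖ ^ 2 ≤ (∑ i ∈ s, w i * ‖d i‖ ^ 2) * ∑ i ∈ s, 1 / w i :=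
  calc ‖∑ i ∈ s, d i‖ ^ 2 ≤ (∑ i ∈ s, ‖d i‖) ^ 2 := by gcongr; exact norm_sum_le _ _
    _ ≤ _ := by
      refine Finset.sum_sq_le_sum_mul_sum_of_sq_le_mul s (fun i hi => ?_) (fun i hi => ?_)
        fun i hi => ?_
      · have := hw i hi
        positivity
      · have := hw i hi
        positivity
      · have := (hw i hi).ne'
        exact le_of_eq (by field_simp)

theorem optimal_norm_bounds_riesz_basis
    {H : Type*} [NormedAddCommGroup H] [InnerProductSpace ℂ H] [CompleteSpace H]
    (w : ℕ → ℝ) (hw : ∀ n, 0 < w n) (c₁ c₂ : ℝ) (hc₁ : 0 < c₁) (hc₂ : 0 < c₂)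
    (v : ℕ → H)
    (hriesz : ∀ (a : ℕ → ℂ) (s : Finset ℕ),
      c₁ * ∑ n ∈ s, w n * ‖a n‖ ^ 2 ≤ ‖∑ n ∈ s, a n • v n‖ ^ 2 ∧
      ‖∑ n ∈ s, a n • v n‖ ^ 2 ≤ c₂ * ∑ n ∈ s, w n * ‖a n‖ ^ 2)
    (n : ℕ) :
    c₁ ≤ (sInf {x : ℝ | ∃ a : ℕ → ℂ,
            x = ‖∑ k ∈ Finset.range (n + 2),
                  ((if k ≤ n then a k else 0) -
                    (if k = 0 then 1 else if k ≤ n + 1 then a (k - 1) else 0)) • v k‖ ^ 2})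
          * ∑ k ∈ Finset.range (n + 2), 1 / w k ∧
    (sInf {x : ℝ | ∃ a : ℕ → ℂ,
        x = ‖∑ k ∈ Finset.range (n + 2),
              ((if k ≤ n then a k else 0) -
                (if k = 0 then 1 else if k ≤ n + 1 then a (k - 1) else 0)) • v k‖ ^ 2})
      * ∑ k ∈ Finset.range (n + 2), 1 / w k ≤ c₂ := by
  change c₁ ≤ sInf {x : ℝ | ∃ a : ℕ → ℂ,
        x = ‖∑ k ∈ Finset.range (n + 2), differenceCoeff n a k • v k‖ ^ 2} * _ ∧
    sInf {x : ℝ | ∃ a : ℕ → ℂ,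
        x = ‖∑ k ∈ Finset.range (n + 2), differenceCoeff n a k • v k‖ ^ 2} * _ ≤ c₂
  set S : ℝ := ∑ k ∈ Finset.range (n + 2), 1 / w k with hS
  have hSpos : 0 < S :=
    Finset.sum_pos (fun k _ => one_div_pos.2 (hw k)) ⟨0, Finset.mem_range.2 (by omega)⟩
  constructor
  · rw [← div_le_iff₀ hSpos]
    refine le_csInf ⟨_, 0, rfl⟩ ?_
    rintro _ ⟨a, rfl⟩
    rw [div_le_iff₀ hSpos]
    have hcs := norm_sum_sq_le_weighted (Finset.range (n + 2)) w (fun k _ => hw k)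
      (differenceCoeff n a)
    rw [sum_differenceCoeff, norm_neg, norm_one, one_pow] at hcs
    calc c₁ = c₁ * 1 := (mul_one _).symm
      _ ≤ c₁ * ((∑ k ∈ Finset.range (n + 2), w k * ‖differenceCoeff n a k‖ ^ 2) * S) := by gcongr
      _ = c₁ * (∑ k ∈ Finset.range (n + 2), w k * ‖differenceCoeff n a k‖ ^ 2) * S := by ring
      _ ≤ _ := by gcongr; exact (hriesz _ _).1
  · rw [← le_div_iff₀ hSpos]
    have hsum : ∑ k ∈ Finset.range (n + 2), ((-(1 / w k / S) : ℝ) : ℂ) = -1 := by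
      rw [← Complex.ofReal_sum, Finset.sum_neg_distrib, ← Finset.sum_div, ← hS,
        div_self hSpos.ne']
      simp
    obtain ⟨a, ha⟩ := exists_differenceCoeff_eq n _ hsum
    refine le_trans (csInf_le ⟨0, ?_⟩ ⟨a, rfl⟩) ((hriesz _ _).2.trans_eq ?_)
    · rintro _ ⟨a, rfl⟩
      positivity
    · have hterm : ∀ k ∈ Finset.range (n + 2),
          w k * ‖differenceCoeff n a k‖ ^ 2 = 1 / w k / S ^ 2 := fun k hk => by
        have := (hw k).ne'
        rw [ha k hk, Complex.norm_real, Real.norm_eq_abs, sq_abs]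
        field_simp
      rw [Finset.sum_congr rfl hterm, ← Finset.sum_div, ← hS]
      field_simp
end

section
/- (Eneström) Let n ≥ 1 and let p(z) = ∑_{k=0}^n a_k z^k be a polynomial whose coefficients a_k are real and strictly positive for 0 ≤ k ≤ n. Then every complex zero z of p satisfies min_{0 ≤ k < n} a_k/a_{k+1} ≤ |z| ≤ max_{0 ≤ k < n} a_k/a_{k+1}. -/
/-- A sum of powers with positive coefficients is positive at nonnegative points. -/
theorem sum_mul_pow_pos {n : ℕ} {a : ℕ → ℝ} (ha : ∀ k ≤ n, 0 < a k) {t : ℝ} (ht : 0 ≤ t) :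
    0 < ∑ k ∈ Finset.range (n + 1), a k * t ^ k := by
  refine Finset.sum_pos' (fun k hk => ?_) ⟨0, by simp, by simpa using ha 0 n.zero_le⟩
  have := ha k (by simpa [Nat.lt_succ_iff] using hk)
  positivity

/-- Multiplying by `z - r` leaves the leading term plus a remainder dominated coefficientwise. -/
theorem norm_sub_mul_sum_sub_le {a : ℕ → ℝ} {r : ℝ} {n : ℕ} (hr : 0 ≤ r * a 0)
    (h : ∀ k < n, a k ≤ r * a (k + 1)) (z : ℂ) :
    ‖(z - r) * ∑ k ∈ Finset.range (n + 1), (a k : ℂ) * z ^ k - a n * z ^ (n + 1)‖ ≤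
      a n * ‖z‖ ^ (n + 1) - (‖z‖ - r) * ∑ k ∈ Finset.range (n + 1), a k * ‖z‖ ^ k := by
  induction n with
  | zero =>
    have e : (z - r) * ∑ k ∈ Finset.range (0 + 1), (a k : ℂ) * z ^ k - a 0 * z ^ (0 + 1) =
        -((r * a 0 : ℝ) : ℂ) := by
      simp; ring
    rw [e, norm_neg, Complex.norm_real, Real.norm_of_nonneg hr]
    simp
    linarith
  | succ n ih =>
    have ih := ih fun k hk => h k (by omega)
    have e : (z - r) * ∑ k ∈ Finset.range (n + 1 + 1), (a k : ℂ) * z ^ k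
          - a (n + 1) * z ^ (n + 1 + 1) =
        ((z - r) * ∑ k ∈ Finset.range (n + 1), (a k : ℂ) * z ^ k - a n * z ^ (n + 1))
          - ((r * a (n + 1) - a n : ℝ) : ℂ) * z ^ (n + 1) := by
      rw [Finset.sum_range_succ _ (n + 1)]; push_cast; ring
    rw [e]
    refine (norm_sub_le _ _).trans ?_
    rw [norm_mul, norm_pow, Complex.norm_real,
      Real.norm_of_nonneg (sub_nonneg.2 (h n n.lt_succ_self)), Finset.sum_range_succ _ (n + 1)]
    linear_combination ih

/-- Multiplying by `r - z` leaves the extreme terms plus a remainder dominated coefficientwise. -/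
theorem norm_mul_sum_add_sub_le {a : ℕ → ℝ} {r : ℝ} {n : ℕ}
    (h : ∀ k < n, r * a (k + 1) ≤ a k) (z : ℂ) :
    ‖(r - z) * ∑ k ∈ Finset.range (n + 1), (a k : ℂ) * z ^ k + a n * z ^ (n + 1)
        - (r * a 0 : ℝ)‖ ≤
      r * a 0 - a n * ‖z‖ ^ (n + 1)
        - (r - ‖z‖) * ∑ k ∈ Finset.range (n + 1), a k * ‖z‖ ^ k := by
  induction n with
  | zero =>
    have e : (r - z) * ∑ k ∈ Finset.range (0 + 1), (a k : ℂ) * z ^ k + a 0 * z ^ (0 + 1)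
        - (r * a 0 : ℝ) = 0 := by
      simp; ring
    rw [e, norm_zero]
    simp
    linarith
  | succ n ih =>
    have ih := ih fun k hk => h k (by omega)
    have e : (r - z) * ∑ k ∈ Finset.range (n + 1 + 1), (a k : ℂ) * z ^ k
          + a (n + 1) * z ^ (n + 1 + 1) - (r * a 0 : ℝ) =
        ((r - z) * ∑ k ∈ Finset.range (n + 1), (a k : ℂ) * z ^ k + a n * z ^ (n + 1)
          - (r * a 0 : ℝ)) - ((a n - r * a (n + 1) : ℝ) : ℂ) * z ^ (n + 1) := by
      rw [Finset.sum_range_succ _ (n + 1)]; push_cast; ring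
    rw [e]
    refine (norm_sub_le _ _).trans ?_
    rw [norm_mul, norm_pow, Complex.norm_real,
      Real.norm_of_nonneg (sub_nonneg.2 (h n n.lt_succ_self)), Finset.sum_range_succ _ (n + 1)]
    linear_combination ih

/-- If `a k ≤ r * a (k + 1)` for all `k < n`, then every zero has modulus at most `r`. -/
theorem norm_le_of_sum_mul_pow_eq_zero {n : ℕ} {a : ℕ → ℝ} (ha : ∀ k ≤ n, 0 < a k) {r : ℝ}
    (hr : 0 ≤ r) (h : ∀ k < n, a k ≤ r * a (k + 1)) {z : ℂ}
    (hz : ∑ k ∈ Finset.range (n + 1), (a k : ℂ) * z ^ k = 0) : ‖z‖ ≤ r := by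
  have key := norm_sub_mul_sum_sub_le (mul_nonneg hr (ha 0 n.zero_le).le) h z
  rw [hz, mul_zero, zero_sub, norm_neg, norm_mul, norm_pow, Complex.norm_real,
    Real.norm_of_nonneg (ha n le_rfl).le] at key
  have hP := sum_mul_pow_pos ha (norm_nonneg z)
  by_contra! hlt
  have := mul_pos (sub_pos.2 hlt) hP
  linarith

/-- If `r * a (k + 1) ≤ a k` for all `k < n`, then every zero has modulus at least `r`. -/
theorem le_norm_of_sum_mul_pow_eq_zero {n : ℕ} {a : ℕ → ℝ} (ha : ∀ k ≤ n, 0 < a k) {r : ℝ}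
    (h : ∀ k < n, r * a (k + 1) ≤ a k) {z : ℂ}
    (hz : ∑ k ∈ Finset.range (n + 1), (a k : ℂ) * z ^ k = 0) : r ≤ ‖z‖ := by
  have key := norm_mul_sum_add_sub_le h z
  rw [hz, mul_zero, zero_add, norm_sub_rev] at key
  have tri := norm_sub_norm_le ((r * a 0 : ℝ) : ℂ) (a n * z ^ (n + 1))
  rw [norm_mul, norm_pow, Complex.norm_real, Complex.norm_real,
    Real.norm_of_nonneg (ha n le_rfl).le] at tri
  have hP := sum_mul_pow_pos ha (norm_nonneg z)
  by_contra! hlt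
  have := mul_pos (sub_pos.2 hlt) hP
  linarith [Real.le_norm_self (r * a 0)]

theorem enestrom
    (n : ℕ) (hn : 1 ≤ n) (a : ℕ → ℝ) (ha : ∀ k ≤ n, 0 < a k)
    (z : ℂ) (hz : ∑ k ∈ Finset.range (n + 1), (a k : ℂ) * z ^ k = 0) :
    (⨅ k : Fin n, a (k : ℕ) / a ((k : ℕ) + 1)) ≤ ‖z‖ ∧
    ‖z‖ ≤ ⨆ k : Fin n, a (k : ℕ) / a ((k : ℕ) + 1) := by
  constructor
  · refine le_norm_of_sum_mul_pow_eq_zero ha (fun k hk => ?_) hz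
    rw [← le_div_iff₀ (ha (k + 1) hk)]
    exact ciInf_le (Set.finite_range fun k : Fin n => a k / a (k + 1)).bddBelow ⟨k, hk⟩
  · refine norm_le_of_sum_mul_pow_eq_zero ha
      (Real.iSup_nonneg fun k : Fin n => (div_pos (ha _ k.2.le) (ha _ k.2)).le) (fun k hk => ?_) hz
    rw [← div_le_iff₀ (ha (k + 1) hk)]
    exact le_ciSup (Set.finite_range fun k : Fin n => a k / a (k + 1)).bddAbove ⟨k, hk⟩
end

section
/- Let w : ℕ → ℝ with w_n > 0 for all n, let n ≥ 1, set φ(k) = ∑_{j=0}^k 1/w_j, and let p*_n(z) = ∑_{k=0}^n (1 − φ(k)/φ(n+1)) z^k. Then every complex zero z of p*_n satisfies |z| > 1 and min_{0 ≤ k < n} w_{k+1} ∑_{j=k+2}^{n+1} 1/w_j ≤ 1/(|z| − 1) ≤ max_{0 ≤ k < n} w_{k+1} ∑_{j=k+2}^{n+1} 1/w_j. -/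
open scoped BigOperators ComplexConjugate
open Filter

open Finset in
theorem norm_sub_one_sub_mul_sum_le (b : ℕ → ℝ) (z : ℂ) (hz : ‖z‖ ≤ 1) (n : ℕ)
    (hb : ∀ k < n, b (k + 1) ≤ b k) :
    ‖(b 0 : ℂ) - b n * z ^ (n + 1) - (1 - z) * ∑ k ∈ range (n + 1), (b k : ℂ) * z ^ k‖
      ≤ ‖z‖ * (b 0 - b n) := by
  induction n with
  | zero =>
    simp
    ring_nf
  | succ n ih =>
    have h := ih fun k hk => hb k (by lia)
    have hn := hb n (by lia)
    have key : (b 0 : ℂ) - b (n + 1) * z ^ (n + 1 + 1)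
          - (1 - z) * ∑ k ∈ range (n + 1 + 1), (b k : ℂ) * z ^ k
        = ((b 0 : ℂ) - b n * z ^ (n + 1) - (1 - z) * ∑ k ∈ range (n + 1), (b k : ℂ) * z ^ k)
          + ((b n - b (n + 1) : ℝ) : ℂ) * z ^ (n + 1) := by
      rw [sum_range_succ _ (n + 1)]
      push_cast
      ring
    have h2 : ‖((b n - b (n + 1) : ℝ) : ℂ) * z ^ (n + 1)‖ ≤ (b n - b (n + 1)) * ‖z‖ := by
      rw [norm_mul, norm_pow, Complex.norm_real, Real.norm_of_nonneg (by linarith)]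
      exact mul_le_mul_of_nonneg_left (pow_le_of_le_one (norm_nonneg _) hz (by lia)) (by linarith)
    rw [key]
    calc _ ≤ _ := norm_add_le _ _
      _ ≤ _ := add_le_add h h2
      _ = _ := by ring

/-- **Eneström–Kakeya**: the zeros of a polynomial with positive decreasing coefficients lie outside
the open unit disc. -/
theorem one_le_norm_of_sum_eq_zero {b : ℕ → ℝ} {z : ℂ} {n : ℕ} (hpos : 0 < b n)
    (hb : ∀ k < n, b (k + 1) ≤ b k)
    (hz : ∑ k ∈ Finset.range (n + 1), (b k : ℂ) * z ^ k = 0) : 1 ≤ ‖z‖ := by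
  by_contra! hlt
  have h := norm_sub_one_sub_mul_sum_le b z hlt.le n hb
  rw [hz, mul_zero, sub_zero] at h
  have h0 : b n ≤ b 0 := by
    clear h hz hpos
    induction n with
    | zero => exact le_rfl
    | succ n ih => exact (hb n (by lia)).trans (ih fun k hk => hb k (by lia))
  have h1 := norm_sub_norm_le (b 0 : ℂ) (b n * z ^ (n + 1))
  rw [norm_mul, norm_pow, Complex.norm_real, Complex.norm_real, Real.norm_of_nonneg hpos.le,
    Real.norm_of_nonneg (hpos.le.trans h0)] at h1
  have h2 : b n * ‖z‖ ^ (n + 1) ≤ b n * ‖z‖ :=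
    mul_le_mul_of_nonneg_left (pow_le_of_le_one (norm_nonneg _) hlt.le (by lia)) hpos.le
  nlinarith

theorem le_norm_of_sum_eq_zero {c : ℕ → ℝ} {z : ℂ} {n : ℕ} {r : ℝ} (hr : 0 < r) (hpos : 0 < c n)
    (hc : ∀ k < n, r * c (k + 1) ≤ c k)
    (hz : ∑ k ∈ Finset.range (n + 1), (c k : ℂ) * z ^ k = 0) : r ≤ ‖z‖ := by
  have hr' : (r : ℂ) ≠ 0 := by exact_mod_cast hr.ne'
  have h : 1 ≤ ‖z / r‖ := by
    refine one_le_norm_of_sum_eq_zero (b := fun k => c k * r ^ k) (n := n) (by positivity) ?_ ?_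
    · intro k hk
      have := mul_le_mul_of_nonneg_right (hc k hk) (pow_pos hr k).le
      calc _ = r * c (k + 1) * r ^ k := by ring
        _ ≤ _ := this
    · rw [← hz]
      refine Finset.sum_congr rfl fun k _ => ?_
      push_cast
      rw [mul_assoc, ← mul_pow, mul_div_cancel₀ _ hr']
  rwa [norm_div, Complex.norm_real, Real.norm_of_nonneg hr.le, one_le_div hr] at h

theorem norm_le_of_sum_eq_zero {c : ℕ → ℝ} {z : ℂ} {n : ℕ} {R : ℝ} (hR : 0 < R) (hpos : 0 < c 0)
    (hc : ∀ k < n, c k ≤ R * c (k + 1))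
    (hz : ∑ k ∈ Finset.range (n + 1), (c k : ℂ) * z ^ k = 0) : ‖z‖ ≤ R := by
  rcases eq_or_ne z 0 with rfl | hz0
  · simpa using hR.le
  have h : R⁻¹ ≤ ‖z⁻¹‖ := by
    refine le_norm_of_sum_eq_zero (c := fun k => c (n - k)) (n := n) (by positivity) (by simpa) ?_ ?_
    · intro k hk
      have := hc (n - (k + 1)) (by lia)
      rw [show n - (k + 1) + 1 = n - k by lia] at this
      rwa [inv_mul_le_iff₀ hR]
    · rw [← Finset.sum_range_reflect, ← mul_zero ((z ^ n)⁻¹), ← hz, Finset.mul_sum]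
      refine Finset.sum_congr rfl fun k hk => ?_
      have hk' : k ≤ n := by simpa [Nat.lt_succ_iff] using hk
      have h1 : n - (n + 1 - 1 - k) = k := by lia
      have h2 : n + 1 - 1 - k = n - k := by lia
      simp only [h1]
      rw [h2, inv_pow, pow_sub₀ z hz0 hk']
      field_simp
  rw [norm_inv] at h
  exact (inv_le_inv₀ hR (norm_pos_iff.2 hz0)).1 h

theorem zeros_of_optimal_approximant
    (w : ℕ → ℝ) (hw : ∀ n, 0 < w n) (n : ℕ) (hn : 1 ≤ n)
    (z : ℂ)
    (hz : ∑ k ∈ Finset.range (n + 1), pstarW w n k * z ^ k = 0) :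
    1 < ‖z‖ ∧
    (⨅ k : Fin n, w ((k : ℕ) + 1) * ∑ j ∈ Finset.Icc ((k : ℕ) + 2) (n + 1), 1 / w j)
      ≤ 1 / (‖z‖ - 1) ∧
    1 / (‖z‖ - 1)
      ≤ ⨆ k : Fin n, w ((k : ℕ) + 1) * ∑ j ∈ Finset.Icc ((k : ℕ) + 2) (n + 1), 1 / w j := by
  have : Nonempty (Fin n) := ⟨⟨0, hn⟩⟩
  let T : ℕ → ℝ := fun m => ∑ j ∈ Finset.Icc m (n + 1), 1 / w j
  have T_pos : ∀ m ≤ n + 1, 0 < T m := fun m hm =>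
    Finset.sum_pos (fun j _ => one_div_pos.2 (hw j)) (Finset.nonempty_Icc.2 hm)
  have T_succ : ∀ m ≤ n + 1, T m = 1 / w m + T (m + 1) := fun m hm => by
    simp only [T]
    rw [← Finset.insert_Icc_succ_left_eq_Icc hm, Finset.sum_insert (by simp)]
    rfl
  have phi_pos : 0 < phiW w (n + 1) :=
    Finset.sum_pos (fun j _ => one_div_pos.2 (hw j)) (by simp)
  have phi_add : ∀ k ≤ n + 1, phiW w k + T (k + 1) = phiW w (n + 1) := fun k hk => by
    simp only [phiW, T]
    rw [← Finset.sum_range_add_sum_Ico _ (show k + 1 ≤ n + 1 + 1 by lia)]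
    rfl
  have hz' : ∑ k ∈ Finset.range (n + 1), ((T (k + 1) : ℝ) : ℂ) * z ^ k = 0 := by
    rw [← mul_zero ((phiW w (n + 1) : ℝ) : ℂ), ← hz, Finset.mul_sum]
    refine Finset.sum_congr rfl fun k hk => ?_
    have hk' : k ≤ n := by simpa [Nat.lt_succ_iff] using hk
    rw [pstarW, if_pos hk', ← mul_assoc, ← Complex.ofReal_mul]
    congr 2
    rw [mul_sub, mul_one, mul_div_cancel₀ _ phi_pos.ne', ← phi_add k (by lia)]
    ring
  let A : Fin n → ℝ := fun k => w ((k : ℕ) + 1) * T ((k : ℕ) + 2)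
  have A_pos : ∀ k, 0 < A k := fun k => mul_pos (hw _) (T_pos _ (by lia))
  have hT : ∀ k : Fin n, T ((k : ℕ) + 1) = (1 + 1 / A k) * T ((k : ℕ) + 1 + 1) := fun k => by
    have h1 := (T_pos ((k : ℕ) + 2) (by lia)).ne'
    have h2 := (hw ((k : ℕ) + 1)).ne'
    rw [T_succ _ (by lia)]
    simp only [A, add_assoc, Nat.reduceAdd]
    field_simp
    ring
  obtain ⟨i, hi⟩ := exists_eq_ciInf_of_finite (f := A)
  obtain ⟨s, hs⟩ := exists_eq_ciSup_of_finite (f := A)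
  change 1 < ‖z‖ ∧ (⨅ k, A k) ≤ 1 / (‖z‖ - 1) ∧ 1 / (‖z‖ - 1) ≤ ⨆ k, A k
  have lower : 1 + 1 / A s ≤ ‖z‖ := by
    refine le_norm_of_sum_eq_zero (c := fun k => T (k + 1)) (n := n)
      (add_pos one_pos (one_div_pos.2 (A_pos s))) (T_pos _ le_rfl) (fun k hk => ?_) hz'
    simp only [hT ⟨k, hk⟩]
    have := one_div_le_one_div_of_le (A_pos ⟨k, hk⟩)
      (hs ▸ le_ciSup (Set.finite_range A).bddAbove ⟨k, hk⟩)
    exact mul_le_mul_of_nonneg_right (by linarith) (T_pos _ (by lia)).le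
  have upper : ‖z‖ ≤ 1 + 1 / A i := by
    refine norm_le_of_sum_eq_zero (c := fun k => T (k + 1)) (n := n)
      (add_pos one_pos (one_div_pos.2 (A_pos i))) (T_pos _ (by lia)) (fun k hk => ?_) hz'
    simp only [hT ⟨k, hk⟩]
    have := one_div_le_one_div_of_le (A_pos i)
      (hi ▸ ciInf_le (Set.finite_range A).bddBelow ⟨k, hk⟩)
    exact mul_le_mul_of_nonneg_right (by linarith) (T_pos _ (by lia)).le
  have hs_pos := one_div_pos.2 (A_pos s)
  have hz1 : 1 < ‖z‖ := by linarith
  refine ⟨hz1, ?_, ?_⟩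
  · rw [← hi, le_one_div (A_pos i) (by linarith)]
    linarith
  · rw [← hs, one_div_le (by linarith) (A_pos s)]
    linarith
end

section
/- Let H be a complex Hilbert space, let w : ℕ → ℝ with w_n > 0 for all n and sup_n w_{n+1}/w_n < ∞, let c_1, c_2 > 0, and let v : ℕ → H be a sequence whose closed linear span is all of H and such that for every finitely supported a : ℕ → ℂ one has c_1 ∑_n w_n |a_n|² ≤ ‖∑_n a_n v_n‖² ≤ c_2 ∑_n w_n |a_n|². If S is a bounded linear operator on H with S v_n = v_{n+1} for all n, then (c_1/c_2) sup_{n ≥ 0} w_{n+1}/w_n ≤ ‖S‖² ≤ (c_2/c_1) sup_{n ≥ 0} w_{n+1}/w_n. -/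
/-- A shift along a weighted Riesz sequence whose weights grow by a factor of at most `M` per step
is bounded on the span of that sequence, with explicit constant `c₂ / c₁ * M`. -/
theorem norm_sq_apply_le_of_riesz_shift
    {H : Type*} [NormedAddCommGroup H] [InnerProductSpace ℂ H]
    {w : ℕ → ℝ} {M c₁ c₂ : ℝ} (hM : ∀ n, w (n + 1) ≤ M * w n)
    (hM0 : 0 ≤ M) (hc₁ : 0 < c₁) (hc₂ : 0 < c₂) {v : ℕ → H}
    (hriesz : ∀ (a : ℕ → ℂ) (s : Finset ℕ),
      c₁ * ∑ n ∈ s, w n * ‖a n‖ ^ 2 ≤ ‖∑ n ∈ s, a n • v n‖ ^ 2 ∧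
      ‖∑ n ∈ s, a n • v n‖ ^ 2 ≤ c₂ * ∑ n ∈ s, w n * ‖a n‖ ^ 2)
    (S : H →L[ℂ] H) (hS : ∀ n, S (v n) = v (n + 1)) {x : H}
    (hx : x ∈ Submodule.span ℂ (Set.range v)) :
    ‖S x‖ ^ 2 ≤ c₂ / c₁ * M * ‖x‖ ^ 2 := by
  obtain ⟨a, rfl⟩ := Finsupp.mem_span_range_iff_exists_finsupp.1 hx
  simp only [Finsupp.sum, map_sum, map_smul, hS]
  have hlow := (hriesz a a.support).1
  have hup := (hriesz (fun n => a (n - 1)) (a.support.map (addRightEmbedding 1))).2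
  simp only [Finset.sum_map, addRightEmbedding_apply, Nat.add_sub_cancel] at hup
  have hratio : ∑ n ∈ a.support, w (n + 1) * ‖a n‖ ^ 2 ≤
      M * ∑ n ∈ a.support, w n * ‖a n‖ ^ 2 := by
    rw [Finset.mul_sum]
    refine Finset.sum_le_sum fun n _ => ?_
    rw [← mul_assoc]
    exact mul_le_mul_of_nonneg_right (hM n) (sq_nonneg _)
  calc
    _ ≤ c₂ * ∑ n ∈ a.support, w (n + 1) * ‖a n‖ ^ 2 := hup
    _ ≤ c₂ * (M * ∑ n ∈ a.support, w n * ‖a n‖ ^ 2) := by gcongr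
    _ = c₂ / c₁ * M * (c₁ * ∑ n ∈ a.support, w n * ‖a n‖ ^ 2) := by field_simp
    _ ≤ _ := mul_le_mul_of_nonneg_left hlow (by positivity)

theorem shift_norm_bounds
    {H : Type*} [NormedAddCommGroup H] [InnerProductSpace ℂ H] [CompleteSpace H]
    (w : ℕ → ℝ) (hw : ∀ n, 0 < w n)
    (hbdd : BddAbove (Set.range fun n => w (n + 1) / w n))
    (c₁ c₂ : ℝ) (hc₁ : 0 < c₁) (hc₂ : 0 < c₂)
    (v : ℕ → H)
    (hspan : (Submodule.span ℂ (Set.range v)).topologicalClosure = ⊤)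
    (hriesz : ∀ (a : ℕ → ℂ) (s : Finset ℕ),
      c₁ * ∑ n ∈ s, w n * ‖a n‖ ^ 2 ≤ ‖∑ n ∈ s, a n • v n‖ ^ 2 ∧
      ‖∑ n ∈ s, a n • v n‖ ^ 2 ≤ c₂ * ∑ n ∈ s, w n * ‖a n‖ ^ 2)
    (S : H →L[ℂ] H) (hS : ∀ n, S (v n) = v (n + 1)) :
    (c₁ / c₂) * (⨆ n : ℕ, w (n + 1) / w n) ≤ ‖S‖ ^ 2 ∧
    ‖S‖ ^ 2 ≤ (c₂ / c₁) * (⨆ n : ℕ, w (n + 1) / w n) := by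
  constructor
  · have hsup : (⨆ n : ℕ, w (n + 1) / w n) ≤ c₂ / c₁ * ‖S‖ ^ 2 := by
      refine ciSup_le fun n => ?_
      have hlow := (hriesz 1 {n + 1}).1
      have hup := (hriesz 1 {n}).2
      simp only [Finset.sum_singleton, Pi.one_apply, norm_one, one_pow, mul_one, one_smul]
        at hlow hup
      have hSv : ‖v (n + 1)‖ ^ 2 ≤ ‖S‖ ^ 2 * ‖v n‖ ^ 2 := by
        rw [← hS n, ← mul_pow]
        gcongr
        exact S.le_opNorm _
      have hmul := mul_le_mul_of_nonneg_left hup (sq_nonneg ‖S‖)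
      rw [div_le_iff₀ (hw n), div_mul_eq_mul_div, div_mul_eq_mul_div, le_div_iff₀ hc₁]
      linarith
    calc
      _ ≤ c₁ / c₂ * (c₂ / c₁ * ‖S‖ ^ 2) := by gcongr
      _ = _ := by field_simp
  · set M := ⨆ n : ℕ, w (n + 1) / w n
    have hM : ∀ n, w (n + 1) / w n ≤ M := le_ciSup hbdd
    have hM0 : 0 ≤ M := (div_pos (hw 1) (hw 0)).le.trans (hM 0)
    have hK : 0 ≤ c₂ / c₁ * M := by positivity
    have hdense : Dense (Submodule.span ℂ (Set.range v) : Set H) :=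
      Submodule.dense_iff_topologicalClosure_eq_top.2 hspan
    have hbound : ∀ x, ‖S x‖ ^ 2 ≤ c₂ / c₁ * M * ‖x‖ ^ 2 := by
      intro x
      refine hdense.induction (P := fun x => ‖S x‖ ^ 2 ≤ c₂ / c₁ * M * ‖x‖ ^ 2) ?_ ?_ x
      · exact fun x hx => norm_sq_apply_le_of_riesz_shift
          (fun n => (div_le_iff₀ (hw n)).1 (hM n)) hM0 hc₁ hc₂ hriesz S hS hx
      · exact isClosed_le (by fun_prop) (by fun_prop)
    refine (Real.le_sqrt (norm_nonneg _) hK).1 ?_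
    refine S.opNorm_le_bound (Real.sqrt_nonneg _) fun x => ?_
    refine le_of_sq_le_sq ?_ (by positivity)
    rw [mul_pow, Real.sq_sqrt hK]
    exact hbound x
end
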